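/- Let n ≥ 2 be an even integer and θ_k = 2πk/n. Then Σ_{(k,l): cos θ_k cos θ_l ≠ 1} 1/(1 - cos θ_k cos θ_l), the sum over (k,l) ∈ {0,...,n-1}² excluding (0,0) and (n/2,n/2), is asymptotically equivalent to (1/π)·n² ln(n²) as n → ∞. -/

import Mathlib

open Real Finset Filter

/-- The sum `Σ 1/(1 - cos θ_k cos θ_l)` over `(k,l) ∈ {0,...,n-1}²` with
`cos θ_k cos θ_l ≠ 1`, where `θ_k = 2πk/n`. -/
noncomputable def Csum (n : ℕ) : ℝ :=
  ∑ p ∈ ((Finset.range n ×ˢ Finset.range n).filter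
      (fun p => Real.cos (2 * π * p.1 / n) * Real.cos (2 * π * p.2 / n) ≠ 1)),
    1 / (1 - Real.cos (2 * π * p.1 / n) * Real.cos (2 * π * p.2 / n))

lemma aux_inv_half {x : ℝ} (h0 : 0 < x) (h1 : x ≤ π / 2) :
    1 / x ≤ 1 / Real.sin x ∧ 1 / Real.sin x ≤ 1 / x + 1 := by
  have hpi := Real.pi_gt_three
  have hpi4 := Real.pi_le_four
  have hs : 0 < Real.sin x := Real.sin_pos_of_pos_of_lt_pi h0 (by linarith)
  have hsx : Real.sin x ≤ x := Real.sin_le h0.le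
  refine ⟨one_div_le_one_div_of_le hs hsx, ?_⟩
  have key : x ≤ (1 + x) * Real.sin x := by
    rcases le_or_gt x 1 with hx | hx
    · have := Real.sin_gt_sub_cube h0
      have h3 : (1 + x) * (x - x ^ 3 / 6) ≤ (1 + x) * Real.sin x :=
        mul_le_mul_of_nonneg_left this.le (by linarith)
      have h4 : 0 ≤ x ^ 2 * (1 - x) := by have : 0 ≤ 1 - x := by linarith
                                          positivity
      have h5 : 0 ≤ x ^ 2 * (1 - x ^ 2) := by
        have : 0 ≤ 1 - x ^ 2 := by nlinarith
        positivity
      nlinarith [sq_nonneg x]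
    · have := Real.mul_le_sin h0.le h1
      have h2 : 1 / 2 * x ≤ 2 / π * x := by
        apply mul_le_mul_of_nonneg_right _ h0.le
        rw [div_le_div_iff₀ (by norm_num) Real.pi_pos]; linarith
      nlinarith
  rw [div_add_one h0.ne', div_le_div_iff₀ hs h0]
  linarith

lemma aux_inv {x : ℝ} (h0 : 0 < x) (h1 : x < π) :
    |1 / Real.sin x - (1 / x + 1 / (π - x))| ≤ 1 := by
  have hpi := Real.pi_gt_three
  have gen : ∀ y : ℝ, 0 < y → y ≤ π / 2 →
      |1 / Real.sin y - (1 / y + 1 / (π - y))| ≤ 1 := by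
    intro y hy hy2
    obtain ⟨a, b⟩ := aux_inv_half hy hy2
    have h3 : 0 < π - y := by linarith
    have h4 : 1 / (π - y) ≤ 1 := by rw [div_le_one h3]; linarith
    have h5 : 0 < 1 / (π - y) := by positivity
    rw [abs_le]; constructor <;> linarith
  rcases le_or_gt x (π / 2) with h | h
  · exact gen x h0 h
  · have := gen (π - x) (by linarith) (by linarith)
    rw [Real.sin_pi_sub, sub_sub_cancel, add_comm (1 / (π - x))] at this
    exact this

lemma aux_sq {x : ℝ} (h0 : 0 < x) (h1 : x < π) :
    1 / Real.sin x ^ 2 ≤ π ^ 2 / 4 * (1 / x ^ 2 + 1 / (π - x) ^ 2) := by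
  have hpi := Real.pi_pos
  have gen : ∀ y : ℝ, 0 < y → y ≤ π / 2 →
      1 / Real.sin y ^ 2 ≤ π ^ 2 / 4 * (1 / y ^ 2 + 1 / (π - y) ^ 2) := by
    intro y hy hy2
    have := Real.mul_le_sin hy.le hy2
    have h1 : 1 / Real.sin y ^ 2 ≤ 1 / (2 / π * y) ^ 2 := by
      apply one_div_le_one_div_of_le (by positivity)
      gcongr
    have h2 : 1 / (2 / π * y) ^ 2 = π ^ 2 / 4 * (1 / y ^ 2) := by
      field_simp; norm_num
    have h3 : 0 ≤ π ^ 2 / 4 * (1 / (π - y) ^ 2) := by positivity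
    rw [mul_add]; linarith
  rcases le_or_gt x (π / 2) with h | h
  · exact gen x h0 h
  · have := gen (π - x) (by linarith) (by linarith)
    rw [Real.sin_pi_sub, sub_sub_cancel, add_comm (1 / (π - x) ^ 2)] at this
    exact this

lemma aux_reflect (f : ℕ → ℝ) (N : ℕ) :
    ∑ k ∈ Finset.Ico 1 N, f (N - k) = ∑ k ∈ Finset.Ico 1 N, f k := by
  apply Finset.sum_nbij' (fun k => N - k) (fun k => N - k)
  all_goals simp only [Finset.mem_Ico]
  all_goals intros
  all_goals first | trivial | omega

lemma aux_sum_sq (N : ℕ) : ∑ k ∈ Finset.Ico 1 N, 1 / (k : ℝ) ^ 2 ≤ 2 := by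
  have key : ∀ M : ℕ, ∑ k ∈ Finset.Ico 1 (M + 2), 1 / (k : ℝ) ^ 2 ≤ 2 - 1 / ((M : ℝ) + 1) := by
    intro M
    induction M with
    | zero => norm_num
    | succ j ih =>
      rw [Finset.sum_Ico_succ_top (by omega)]
      have : 1 / ((j + 1 + 1 : ℕ) : ℝ) ^ 2 ≤ 1 / ((j : ℝ) + 1) - 1 / (((j + 1 : ℕ) : ℝ) + 1) := by
        push_cast
        rw [div_sub_div _ _ (by positivity) (by positivity),
          div_le_div_iff₀ (by positivity) (by positivity)]
        have : (0 : ℝ) ≤ j := Nat.cast_nonneg j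
        nlinarith
      have e : j + 1 + 1 = j + 2 := rfl
      rw [e] at *
      linarith
  have hmono : ∑ k ∈ Finset.Ico 1 N, 1 / (k : ℝ) ^ 2 ≤
      ∑ k ∈ Finset.Ico 1 (N + 2), 1 / (k : ℝ) ^ 2 := by
    apply Finset.sum_le_sum_of_subset_of_nonneg
    · exact Finset.Ico_subset_Ico_right (by omega)
    · intros; positivity
  have h2 : (0 : ℝ) < 1 / ((N : ℝ) + 1) := by positivity
  linarith [key N]

lemma aux_sum_inv_sin_sq (N : ℕ) :
    ∑ k ∈ Finset.Ico 1 N, 1 / Real.sin (π * k / N) ^ 2 ≤ (N : ℝ) ^ 2 := by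
  have hpi := Real.pi_pos
  have h1 : ∀ k ∈ Finset.Ico 1 N, 1 / Real.sin (π * k / N) ^ 2 ≤
      (N : ℝ) ^ 2 / 4 * (1 / (k : ℝ) ^ 2 + 1 / ((N - k : ℕ) : ℝ) ^ 2) := by
    intro k hk
    rw [Finset.mem_Ico] at hk
    have hk0 : (0 : ℝ) < k := by exact_mod_cast hk.1
    have hkN : (k : ℝ) < N := by exact_mod_cast hk.2
    have hN : (0 : ℝ) < N := by linarith
    have := aux_sq (x := π * k / N) (by positivity) (by rw [div_lt_iff₀ hN]; gcongr)
    refine this.trans (le_of_eq ?_)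
    rw [Nat.cast_sub hk.2.le]
    have h2 : (N : ℝ) - k ≠ 0 := by linarith
    have h3 : π - π * k / N = π * (N - k) / N := by field_simp
    rw [h3]
    field_simp
  refine (Finset.sum_le_sum h1).trans ?_
  rw [← Finset.mul_sum, Finset.sum_add_distrib, aux_reflect (fun k => 1 / (k : ℝ) ^ 2)]
  nlinarith [aux_sum_sq N, sq_nonneg (N : ℝ)]

lemma aux_sum_inv_sin (m : ℕ) :
    |∑ k ∈ Finset.Ico 1 m, 1 / Real.sin (π * k / m)
      - 2 * m / π * ∑ k ∈ Finset.Ico 1 m, 1 / (k : ℝ)| ≤ m := by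
  have hpi := Real.pi_pos
  have h1 : ∀ k ∈ Finset.Ico 1 m, |1 / Real.sin (π * k / m) -
      m / π * (1 / (k : ℝ) + 1 / ((m - k : ℕ) : ℝ))| ≤ 1 := by
    intro k hk
    rw [Finset.mem_Ico] at hk
    have hk0 : (0 : ℝ) < k := by exact_mod_cast hk.1
    have hkN : (k : ℝ) < m := by exact_mod_cast hk.2
    have hN : (0 : ℝ) < m := by linarith
    have := aux_inv (x := π * k / m) (by positivity) (by rw [div_lt_iff₀ hN]; gcongr)
    convert this using 3
    rw [Nat.cast_sub hk.2.le]
    have h2 : (m : ℝ) - k ≠ 0 := by linarith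
    have h3 : π - π * k / m = π * (m - k) / m := by field_simp
    rw [h3]
    field_simp
  have h2 : ∑ k ∈ Finset.Ico 1 m, 1 / Real.sin (π * k / m)
      - 2 * m / π * ∑ k ∈ Finset.Ico 1 m, 1 / (k : ℝ) =
      ∑ k ∈ Finset.Ico 1 m, (1 / Real.sin (π * k / m) -
      m / π * (1 / (k : ℝ) + 1 / ((m - k : ℕ) : ℝ))) := by
    rw [Finset.sum_sub_distrib, ← Finset.mul_sum, Finset.sum_add_distrib,
      aux_reflect (fun k => 1 / (k : ℝ))]
    ring
  rw [h2]
  refine (Finset.abs_sum_le_sum_abs _ _).trans ((Finset.sum_le_sum h1).trans ?_)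
  simp

/-- Sum of the Poisson kernel over roots of unity. -/
lemma aux_poisson (n : ℕ) (hn : 0 < n) (r : ℝ) (hr : |r| < 1) :
    ∑ l ∈ Finset.range n, (1 - r ^ 2) / (1 - 2 * r * Real.cos (2 * π * l / n) + r ^ 2)
      = n * (1 + r ^ n) / (1 - r ^ n) := by
  have hn0 : (n : ℂ) ≠ 0 := by exact_mod_cast hn.ne'
  set z : ℂ := Complex.exp (2 * π * Complex.I / n) with hz
  have hprim : IsPrimitiveRoot z n := Complex.isPrimitiveRoot_exp n hn.ne'
  have hrn : |r ^ n| < 1 := by rw [abs_pow]; exact pow_lt_one₀ (abs_nonneg r) hr hn.ne'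
  have hrn1 : (1 : ℝ) - r ^ n ≠ 0 := by have := (abs_lt.mp hrn).2; linarith
  have hrn1C : (1 : ℂ) - (r : ℂ) ^ n ≠ 0 := by exact_mod_cast hrn1
  have hne : ∀ l : ℕ, 1 - (r : ℂ) * z ^ l ≠ 0 := by
    intro l h
    have h1 : ((r : ℂ) * z ^ l) ^ n = 1 := by rw [← sub_eq_zero.mp h, one_pow]
    rw [mul_pow, ← pow_mul, mul_comm l n, pow_mul, hprim.pow_eq_one, one_pow, mul_one] at h1
    exact hrn1C (by rw [h1, sub_self])
  -- sum of the resolvents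
  have hsum : ∑ l ∈ Finset.range n, 1 / (1 - (r : ℂ) * z ^ l) = n / (1 - (r : ℂ) ^ n) := by
    have h1 : ∀ l ∈ Finset.range n, 1 / (1 - (r : ℂ) * z ^ l) =
        (∑ j ∈ Finset.range n, (r : ℂ) ^ j * (z ^ j) ^ l) / (1 - (r : ℂ) ^ n) := by
      intro l _
      rw [div_eq_div_iff (hne l) hrn1C, one_mul]
      have := mul_neg_geom_sum ((r : ℂ) * z ^ l) n
      rw [mul_pow, ← pow_mul, mul_comm l n, pow_mul, hprim.pow_eq_one, one_pow, mul_one] at this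
      rw [← this, mul_comm]
      congr 1
      apply Finset.sum_congr rfl
      intro j _
      rw [mul_pow, ← pow_mul, ← pow_mul, mul_comm l j]
    rw [Finset.sum_congr rfl h1, ← Finset.sum_div, Finset.sum_comm]
    congr 1
    rw [Finset.sum_eq_single_of_mem 0 (Finset.mem_range.mpr hn)]
    · simp
    · intro j hj hj0
      rw [← Finset.mul_sum]
      have hzj : z ^ j ≠ 1 := hprim.pow_ne_one_of_pos_of_lt hj0 (Finset.mem_range.mp hj)
      rw [geom_sum_eq hzj, ← pow_mul, mul_comm j n, pow_mul, hprim.pow_eq_one, one_pow]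
      simp
  have hterm : ∀ l ∈ Finset.range n,
      (1 - r ^ 2) / (1 - 2 * r * Real.cos (2 * π * l / n) + r ^ 2) =
      2 * (1 / (1 - (r : ℂ) * z ^ l)).re - 1 := by
    intro l _
    have hzl : z ^ l = Complex.exp ((2 * π * l / n : ℝ) * Complex.I) := by
      rw [hz, ← Complex.exp_nat_mul]; congr 1; push_cast; ring
    have h0 := hne l
    rw [hzl] at h0 ⊢
    set t : ℝ := 2 * π * l / n
    have hsq := Real.sin_sq_add_cos_sq t
    have hre : (1 - (r : ℂ) * Complex.exp (t * Complex.I)).re = 1 - r * Real.cos t := by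
      simp [Complex.exp_ofReal_mul_I_re]
    have him : (1 - (r : ℂ) * Complex.exp (t * Complex.I)).im = - (r * Real.sin t) := by
      simp [Complex.exp_ofReal_mul_I_im]
    have hns : Complex.normSq (1 - (r : ℂ) * Complex.exp (t * Complex.I)) =
        1 - 2 * r * Real.cos t + r ^ 2 := by
      rw [Complex.normSq_apply, hre, him]
      linear_combination r ^ 2 * hsq
    have hns0 := Complex.normSq_eq_zero.not.mpr h0
    rw [one_div, Complex.inv_re, hre, hns]
    rw [hns] at hns0
    rw [eq_sub_iff_add_eq, ← mul_div_assoc, div_add_one hns0, div_left_inj' hns0]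
    ring
  rw [Finset.sum_congr rfl hterm, Finset.sum_sub_distrib, ← Finset.mul_sum, ← Complex.re_sum, hsum]
  have : ((n : ℂ) / (1 - (r : ℂ) ^ n)).re = n / (1 - r ^ n) := by
    have : (n : ℂ) / (1 - (r : ℂ) ^ n) = ((n / (1 - r ^ n) : ℝ) : ℂ) := by push_cast; rfl
    rw [this, Complex.ofReal_re]
  rw [this]
  simp
  field_simp
  ring

/-- A row sum. -/
lemma aux_row (m : ℕ) (hm : 0 < m) (c s : ℝ) (hs : 0 < s) (hcs : s ^ 2 + c ^ 2 = 1) :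
    2 * m / s ≤ ∑ l ∈ Finset.range (2 * m), 1 / (1 - c * Real.cos (2 * π * l / (2 * m : ℕ))) ∧
    ∑ l ∈ Finset.range (2 * m), 1 / (1 - c * Real.cos (2 * π * l / (2 * m : ℕ)))
      ≤ 2 * m / s + 4 / s ^ 2 := by
  have hm' : (0 : ℝ) < m := by exact_mod_cast hm
  have hs1 : s ≤ 1 := by nlinarith [sq_nonneg c]
  set r := c / (1 + s) with hr
  have hr2 : r ^ 2 = (1 - s) / (1 + s) := by
    rw [hr, div_pow, div_eq_div_iff (by positivity) (by positivity)]
    linear_combination (1 + s) * hcs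
  have hq0 : 0 ≤ r ^ 2 := sq_nonneg r
  have hq1 : r ^ 2 < 1 := by rw [hr2, div_lt_one (by positivity)]; linarith
  have hra : |r| < 1 := by
    rw [← sq_lt_one_iff_abs_lt_one]; exact hq1
  have hP := aux_poisson (2 * m) (by omega) r hra
  have hterm : ∀ l ∈ Finset.range (2 * m),
      1 / (1 - c * Real.cos (2 * π * l / (2 * m : ℕ))) = 1 / s *
      ((1 - r ^ 2) / (1 - 2 * r * Real.cos (2 * π * l / (2 * m : ℕ)) + r ^ 2)) := by
    intro l _
    set x := Real.cos (2 * π * l / (2 * m : ℕ))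
    have e1 : 1 - r ^ 2 = 2 * s / (1 + s) := by rw [hr2]; field_simp; ring
    have e2 : 1 - 2 * r * x + r ^ 2 = 2 * (1 - c * x) / (1 + s) := by
      rw [hr2, hr]; field_simp; ring
    rw [e1, e2, div_div_div_cancel_right₀ (by positivity), mul_div_mul_left _ _ (by norm_num)]
    rw [div_mul_div_comm, one_mul, div_mul_eq_div_div, div_self hs.ne']
  rw [Finset.sum_congr rfl hterm, ← Finset.mul_sum, hP, pow_mul]
  set Q := (r ^ 2) ^ m with hQ
  have hQ0 : 0 ≤ Q := by positivity
  have hQ1 : Q < 1 := pow_lt_one₀ hq0 hq1 hm.ne'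
  have hB : Q * (1 + m * s) ≤ 1 := by
    have h1 : 1 + (m : ℝ) * s ≤ (1 + s) ^ m := one_add_mul_le_pow (by linarith) m
    calc Q * (1 + m * s) ≤ Q * (1 + s) ^ m := by gcongr
      _ = (1 - s) ^ m := by
        rw [hQ, ← mul_pow, hr2, div_mul_cancel₀ _ (by positivity)]
      _ ≤ 1 := pow_le_one₀ (by linarith) (by linarith)
  have hd : 0 < 1 - Q := by linarith
  have e : 1 / s * (((2 * m : ℕ) : ℝ) * (1 + Q) / (1 - Q)) = 2 * m / s + 4 * m / s * (Q / (1 - Q)) := by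
    push_cast; field_simp; ring
  rw [e]
  constructor
  · have : 0 ≤ 4 * m / s * (Q / (1 - Q)) := by positivity
    linarith
  · have h1 : Q / (1 - Q) ≤ 1 / (m * s) := by
      rw [div_le_div_iff₀ hd (by positivity)]; linarith
    have h2 : 4 * m / s * (Q / (1 - Q)) ≤ 4 * m / s * (1 / (m * s)) := by gcongr
    have h3 : 4 * m / s * (1 / (m * s)) = 4 / s ^ 2 := by field_simp
    linarith

lemma aux_Csum (n : ℕ) : Csum n = ∑ k ∈ Finset.range n, ∑ l ∈ Finset.range n,
    1 / (1 - Real.cos (2 * π * k / n) * Real.cos (2 * π * l / n)) := by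
  rw [Csum, Finset.sum_filter, Finset.sum_product]
  apply Finset.sum_congr rfl; intro k _
  apply Finset.sum_congr rfl; intro l _
  split_ifs with h
  · rfl
  · simp only [ne_eq, not_not] at h
    simp [h]

lemma aux_shift (m : ℕ) (hm : 0 < m) (k : ℕ) :
    Real.cos (2 * π * (m + k : ℕ) / (2 * m : ℕ)) = - Real.cos (2 * π * k / (2 * m : ℕ)) := by
  have hm' : (0 : ℝ) < m := by exact_mod_cast hm
  rw [← Real.cos_add_pi]
  congr 1
  push_cast
  field_simp
  ring

lemma aux_row_neg (m : ℕ) (hm : 0 < m) (c : ℝ) :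
    ∑ l ∈ Finset.range (2 * m), 1 / (1 - (-c) * Real.cos (2 * π * l / (2 * m : ℕ))) =
    ∑ l ∈ Finset.range (2 * m), 1 / (1 - c * Real.cos (2 * π * l / (2 * m : ℕ))) := by
  have h : ∀ f : ℕ → ℝ, ∑ l ∈ Finset.range (2 * m), f l =
      ∑ l ∈ Finset.range m, f l + ∑ l ∈ Finset.range m, f (m + l) := by
    intro f; rw [two_mul, Finset.sum_range_add]
  rw [h, h]
  simp only [aux_shift m hm, neg_mul, mul_neg, neg_neg]
  rw [add_comm]

lemma aux_Csum_half (m : ℕ) (hm : 0 < m) : Csum (2 * m) =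
    2 * (∑ l ∈ Finset.range (2 * m), 1 / (1 - 1 * Real.cos (2 * π * l / (2 * m : ℕ))) +
    ∑ k ∈ Finset.Ico 1 m, ∑ l ∈ Finset.range (2 * m),
      1 / (1 - Real.cos (2 * π * k / (2 * m : ℕ)) * Real.cos (2 * π * l / (2 * m : ℕ)))) := by
  have h : ∀ f : ℕ → ℝ, ∑ l ∈ Finset.range (2 * m), f l =
      ∑ l ∈ Finset.range m, f l + ∑ l ∈ Finset.range m, f (m + l) := by
    intro f; rw [two_mul, Finset.sum_range_add]
  rw [aux_Csum, h]
  simp only [aux_shift m hm, aux_row_neg m hm]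
  rw [← two_mul, Finset.range_eq_Ico, Finset.sum_eq_sum_Ico_succ_bot hm]
  simp

lemma aux_row_zero (m : ℕ) (hm : 0 < m) :
    0 ≤ ∑ l ∈ Finset.range (2 * m), 1 / (1 - 1 * Real.cos (2 * π * l / (2 * m : ℕ))) ∧
    ∑ l ∈ Finset.range (2 * m), 1 / (1 - 1 * Real.cos (2 * π * l / (2 * m : ℕ))) ≤ 2 * m ^ 2 := by
  constructor
  · apply Finset.sum_nonneg
    intro l _
    have := Real.cos_le_one (2 * π * l / (2 * m : ℕ))
    apply one_div_nonneg.mpr; linarith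
  · rw [Finset.range_eq_Ico, Finset.sum_eq_sum_Ico_succ_bot (by omega)]
    have h1 : ∀ l ∈ Finset.Ico (0 + 1) (2 * m),
        1 / (1 - 1 * Real.cos (2 * π * l / (2 * m : ℕ))) =
        1 / 2 * (1 / Real.sin (π * l / (2 * m : ℕ)) ^ 2) := by
      intro l _
      have : 2 * π * l / (2 * m : ℕ) = 2 * (π * l / (2 * m : ℕ)) := by ring
      rw [this, Real.cos_two_mul, Real.cos_sq', one_div_mul_one_div]
      congr 1; ring
    rw [Finset.sum_congr rfl h1, ← Finset.mul_sum]
    have := aux_sum_inv_sin_sq (2 * m)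
    push_cast at this ⊢
    simp
    norm_num at this
    nlinarith

lemma aux_harm (m : ℕ) (hm : 0 < m) :
    |∑ k ∈ Finset.Ico 1 m, 1 / (k : ℝ) - Real.log (2 * m)| ≤ 2 := by
  obtain ⟨j, rfl⟩ : ∃ j, m = j + 1 := ⟨m - 1, by omega⟩
  have e : ∑ k ∈ Finset.Ico 1 (j + 1), 1 / (k : ℝ) = (harmonic j : ℝ) := by
    rw [harmonic, Finset.sum_Ico_eq_sum_range]
    push_cast
    apply Finset.sum_congr rfl
    intros
    rw [one_div, add_comm]
  rw [e]
  have h1 := log_add_one_le_harmonic j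
  have h2 := harmonic_le_one_add_log j
  have h3 : Real.log (j : ℝ) ≤ Real.log (j + 1 : ℕ) := by
    rcases Nat.eq_zero_or_pos j with rfl | hj
    · simp
    · apply Real.log_le_log (by exact_mod_cast hj); push_cast; linarith
  have h4 : Real.log (2 * (j + 1 : ℕ)) = Real.log 2 + Real.log (j + 1 : ℕ) :=
    Real.log_mul (by norm_num) (by positivity)
  have h5 := Real.log_two_lt_d9
  have h6 := Real.log_two_gt_d9
  rw [h4, abs_le]
  constructor <;> linarith

lemma aux_main (m : ℕ) (hm : 0 < m) :
    |Csum (2 * m) - 8 * m ^ 2 / π * Real.log (2 * m)| ≤ 40 * (m : ℝ) ^ 2 := by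
  have hm' : (0 : ℝ) < m := by exact_mod_cast hm
  have hpi := Real.pi_gt_three
  obtain ⟨z0, z1⟩ := aux_row_zero m hm
  have hrow : ∀ k ∈ Finset.Ico 1 m, 2 * m * (1 / Real.sin (π * k / m)) ≤
      (∑ l ∈ Finset.range (2 * m),
      1 / (1 - Real.cos (2 * π * k / (2 * m : ℕ)) * Real.cos (2 * π * l / (2 * m : ℕ)))) ∧
      (∑ l ∈ Finset.range (2 * m),
      1 / (1 - Real.cos (2 * π * k / (2 * m : ℕ)) * Real.cos (2 * π * l / (2 * m : ℕ)))) ≤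
      2 * m * (1 / Real.sin (π * k / m)) + 4 * (1 / Real.sin (π * k / m) ^ 2) := by
    intro k hk
    rw [Finset.mem_Ico] at hk
    have hk0 : (0 : ℝ) < k := by exact_mod_cast hk.1
    have hkN : (k : ℝ) < m := by exact_mod_cast hk.2
    have hs : 0 < Real.sin (π * k / m) := by
      apply Real.sin_pos_of_pos_of_lt_pi (by positivity)
      rw [div_lt_iff₀ hm']; gcongr
    have := aux_row m hm (Real.cos (2 * π * k / (2 * m : ℕ))) _ hs (by
      have : 2 * π * k / (2 * m : ℕ) = π * k / m := by push_cast; field_simp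
      rw [this]; exact Real.sin_sq_add_cos_sq _)
    rw [mul_one_div, mul_one_div]
    exact this
  have lo := Finset.sum_le_sum (fun k hk => (hrow k hk).1)
  have hi := Finset.sum_le_sum (fun k hk => (hrow k hk).2)
  rw [Finset.sum_add_distrib, ← Finset.mul_sum, ← Finset.mul_sum] at hi
  rw [← Finset.mul_sum] at lo
  have hsq := aux_sum_inv_sin_sq m
  have hS := aux_sum_inv_sin m
  have hH := aux_harm m hm
  rw [aux_Csum_half m hm]
  set Z := ∑ l ∈ Finset.range (2 * m), 1 / (1 - 1 * Real.cos (2 * π * l / (2 * m : ℕ)))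
  set R := ∑ k ∈ Finset.Ico 1 m, ∑ l ∈ Finset.range (2 * m),
      1 / (1 - Real.cos (2 * π * k / (2 * m : ℕ)) * Real.cos (2 * π * l / (2 * m : ℕ)))
  set S := ∑ k ∈ Finset.Ico 1 m, 1 / Real.sin (π * k / m)
  set H := ∑ k ∈ Finset.Ico 1 m, 1 / (k : ℝ)
  set L := Real.log (2 * m)
  have a1 : |2 * (Z + R) - 4 * m * S| ≤ 12 * (m : ℝ) ^ 2 := by
    rw [abs_le]; constructor <;> nlinarith
  have a2 : |4 * m * S - 8 * m ^ 2 / π * H| ≤ 4 * (m : ℝ) ^ 2 := by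
    have : 4 * m * S - 8 * m ^ 2 / π * H = 4 * m * (S - 2 * m / π * H) := by ring
    rw [this, abs_mul, abs_of_pos (by positivity)]
    nlinarith
  have a3 : |8 * m ^ 2 / π * H - 8 * m ^ 2 / π * L| ≤ 16 * (m : ℝ) ^ 2 := by
    rw [← mul_sub, abs_mul, abs_of_pos (by positivity)]
    have : 8 * m ^ 2 / π ≤ 8 * (m : ℝ) ^ 2 := div_le_self (by positivity) (by linarith)
    calc _ ≤ 8 * (m : ℝ) ^ 2 * 2 := by gcongr
      _ = _ := by ring
  rw [abs_le] at *
  constructor <;> nlinarith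

theorem Csum_asymptotic :
    Tendsto (fun m : ℕ =>
        Csum (2 * m) / ((1 / π) * (2 * m : ℝ) ^ 2 * Real.log ((2 * m : ℝ) ^ 2)))
      atTop (nhds 1) := by
  have hpi := Real.pi_pos
  have hlog : Tendsto (fun m : ℕ => Real.log (2 * (m : ℝ))) atTop atTop :=
    Real.tendsto_log_atTop.comp
      (tendsto_natCast_atTop_atTop.const_mul_atTop (by norm_num : (0 : ℝ) < 2))
  have hz : Tendsto (fun m : ℕ => 5 * π / Real.log (2 * (m : ℝ))) atTop (nhds 0) :=
    hlog.const_div_atTop _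
  rw [tendsto_iff_norm_sub_tendsto_zero]
  refine squeeze_zero' (Eventually.of_forall fun _ => norm_nonneg _) ?_ hz
  filter_upwards [eventually_gt_atTop 0] with m hm
  have hm' : (1 : ℝ) ≤ m := by exact_mod_cast hm
  have hL : 0 < Real.log (2 * (m : ℝ)) := Real.log_pos (by linarith)
  have h := aux_main m hm
  rw [Real.log_pow]
  set L := Real.log (2 * (m : ℝ))
  have e : Csum (2 * m) / (1 / π * (2 * (m : ℝ)) ^ 2 * ((2 : ℕ) * L)) - 1 =
      (Csum (2 * m) - 8 * m ^ 2 / π * L) * (π / (8 * m ^ 2 * L)) := by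
    push_cast; field_simp; ring
  rw [e, Real.norm_eq_abs, abs_mul, abs_of_pos (a := π / (8 * m ^ 2 * L)) (by positivity)]
  calc _ ≤ 40 * (m : ℝ) ^ 2 * (π / (8 * m ^ 2 * L)) := by gcongr
    _ = _ := by field_simp; norm_num
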